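/- Fix an integer $s \ge 2$ and a sign $\eta \in \{+1,-1\}$. There is a constant $C = C(s)$ such that for all real $x \ge 2$ and all real $J, K \ge 1$, the quantity $N = \#\{(j, k, u, v) \in \mathbb{Z}_{>0}^4 : J < j \le 2J,\ K < k \le 2K,\ j^s u + \eta = k^s v,\ k^s v \le x\}$ satisfies $N \le C\, x \left( J^{-s} K + (JK)^{1-s} \right) (\log x)^{s-1}$. -/

import Mathlib

theorem ncard_pow_eq_one_congr {G H : Type*} [Monoid G] [Monoid H] (e : G ≃* H) (s : ℕ) :
    {x : G | x ^ s = 1}.ncard = {x : H | x ^ s = 1}.ncard := by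
  refine Set.ncard_congr (fun x _ ↦ e x) ?_ (fun _ _ _ _ h ↦ e.injective h) ?_
  · intro x hx
    simpa [← map_pow] using hx
  · intro y hy
    refine ⟨e.symm y, ?_, e.apply_symm_apply y⟩
    simpa [← map_pow] using hy

theorem ncard_pow_eq_one_prod (G H : Type*) [Monoid G] [Monoid H] (s : ℕ) :
    {x : G × H | x ^ s = 1}.ncard = {x : G | x ^ s = 1}.ncard * {x : H | x ^ s = 1}.ncard := by
  rw [← Set.ncard_prod]
  congr 1
  ext x
  simp [Prod.ext_iff]

theorem IsCyclic.ncard_pow_eq_one_le {G : Type*} [Group G] [Finite G] [IsCyclic G] {s : ℕ}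
    (hs : 0 < s) : {x : G | x ^ s = 1}.ncard ≤ s := by
  classical
  have := Fintype.ofFinite G
  refine le_trans (le_of_eq ?_) (IsCyclic.card_pow_eq_one_le (α := G) hs)
  rw [← Set.ncard_coe_finset]
  simp

theorem ncard_pow_eq_one_le_index_mul {G : Type*} [CommGroup G] [Finite G] (H : Subgroup G)
    [IsCyclic H] {s : ℕ} (hs : 0 < s) : {x : G | x ^ s = 1}.ncard ≤ H.index * s := by
  classical
  have := Fintype.ofFinite G
  have := Fintype.ofFinite (G ⧸ H)
  have hset : {x : G | x ^ s = 1} = ↑(Finset.univ.filter fun x : G ↦ x ^ s = 1) := by simp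
  rw [hset, Set.ncard_coe_finset, mul_comm, Subgroup.index_eq_card, Nat.card_eq_fintype_card]
  refine Finset.card_le_mul_card_image_of_maps_to (t := (Finset.univ : Finset (G ⧸ H)))
    (f := QuotientGroup.mk) (fun _ _ ↦ Finset.mem_univ _) s fun q _ ↦ ?_
  rcases Finset.eq_empty_or_nonempty
    ((Finset.univ.filter fun x : G ↦ x ^ s = 1).filter fun x : G ↦
      (QuotientGroup.mk x : G ⧸ H) = q) with h | ⟨y, hy⟩
  · simp [h]
  simp only [Finset.mem_filter, Finset.mem_univ, true_and] at hy
  refine le_trans ?_ (IsCyclic.ncard_pow_eq_one_le (G := H) hs)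
  rw [← Set.ncard_coe_finset]
  refine Set.ncard_le_ncard_of_injOn
    (fun x ↦ if h : y⁻¹ * x ∈ H then (⟨y⁻¹ * x, h⟩ : H) else 1) ?_ ?_ (Set.toFinite _)
  · intro x hx
    simp only [Finset.coe_filter, Finset.mem_filter, Finset.mem_univ, true_and,
      Set.mem_ofPred_eq] at hx
    have hmem : y⁻¹ * x ∈ H := QuotientGroup.eq.mp (hy.2.trans hx.2.symm)
    simp [hmem, Subtype.ext_iff, mul_pow, hx.1, hy.1]
  · intro x hx x' hx' h
    simp only [Finset.coe_filter, Finset.mem_filter, Finset.mem_univ, true_and,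
      Set.mem_ofPred_eq] at hx hx'
    have hmem : y⁻¹ * x ∈ H := QuotientGroup.eq.mp (hy.2.trans hx.2.symm)
    have hmem' : y⁻¹ * x' ∈ H := QuotientGroup.eq.mp (hy.2.trans hx'.2.symm)
    simpa [hmem, hmem'] using h

theorem ZMod.ncard_units_two_pow_pow_eq_one_le (m : ℕ) {s : ℕ} (hs : 0 < s) :
    {x : (ZMod (2 ^ m))ˣ | x ^ s = 1}.ncard ≤ 2 * s := by
  rcases le_or_gt m 2 with hm | hm
  · have := (ZMod.isCyclic_units_two_pow_iff m).mpr hm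
    have := IsCyclic.ncard_pow_eq_one_le (G := (ZMod (2 ^ m))ˣ) hs
    lia
  obtain ⟨n, rfl⟩ : ∃ n, m = n + 2 := ⟨m - 2, by lia⟩
  have h5 : IsUnit (5 : ZMod (2 ^ (n + 2))) := by
    have : IsUnit ((5 : ℕ) : ZMod (2 ^ (n + 2))) := by
      rw [ZMod.isUnit_iff_coprime]
      exact Nat.Coprime.pow_right _ (by norm_num)
    exact_mod_cast this
  have hord : orderOf h5.unit = 2 ^ n := by
    rw [← orderOf_units, IsUnit.unit_spec, ZMod.orderOf_five]
  have hindex : (Subgroup.zpowers h5.unit).index = 2 := by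
    have h := (Subgroup.zpowers h5.unit).card_mul_index
    rw [Nat.card_zpowers, hord, Nat.card_eq_fintype_card, ZMod.card_units_eq_totient,
      Nat.totient_prime_pow_succ Nat.prime_two] at h
    have : 0 < 2 ^ n := by positivity
    exact Nat.eq_of_mul_eq_mul_left this (by rw [h]; ring)
  have := ncard_pow_eq_one_le_index_mul (Subgroup.zpowers h5.unit) hs
  rwa [hindex] at this

theorem ZMod.ncard_units_pow_eq_one_le {n s : ℕ} (hn : n ≠ 0) (hs : 0 < s) :
    {x : (ZMod n)ˣ | x ^ s = 1}.ncard ≤ Nat.gcd 2 n * s ^ n.primeFactors.card := by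
  induction n using Nat.recOnPosPrimePosCoprime with
  | zero => exact absurd rfl hn
  | one =>
    have hsub : {x : (ZMod 1)ˣ | x ^ s = 1}.ncard ≤ 1 := Set.ncard_le_one_of_subsingleton _
    simpa using hsub
  | prime_pow p m hp hm =>
    rw [Nat.primeFactors_prime_pow hm.ne' hp, Finset.card_singleton, pow_one]
    rcases eq_or_ne p 2 with rfl | hp2
    · rw [Nat.gcd_eq_left (dvd_pow_self 2 hm.ne')]
      exact ZMod.ncard_units_two_pow_pow_eq_one_le m hs
    · have := ZMod.isCyclic_units_of_prime_pow p hp hp2 m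
      have : NeZero (p ^ m) := ⟨hn⟩
      have hcop : Nat.gcd 2 (p ^ m) = 1 :=
        Nat.Coprime.pow_right _ ((Nat.coprime_primes Nat.prime_two hp).mpr hp2.symm)
      rw [hcop, one_mul]
      exact IsCyclic.ncard_pow_eq_one_le hs
  | coprime a b ha hb hab iha ihb =>
    let e : (ZMod (a * b))ˣ ≃* (ZMod a)ˣ × (ZMod b)ˣ :=
      (Units.mapEquiv (ZMod.chineseRemainder hab).toMulEquiv).trans MulEquiv.prodUnits
    rw [ncard_pow_eq_one_congr e, ncard_pow_eq_one_prod, hab.gcd_mul, hab.primeFactors_mul,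
      Finset.card_union_of_disjoint hab.disjoint_primeFactors, pow_add]
    calc _ ≤ _ := Nat.mul_le_mul (iha (by lia)) (ihb (by lia))
      _ = _ := by ring

open Finset in
theorem succ_pow_card_primeFactors_le_sum_divisors (m n : ℕ) (hn : n ≠ 0) :
    (m + 1) ^ n.primeFactors.card ≤ ∑ d ∈ n.divisors, m ^ d.primeFactors.card := by
  classical
  have hprime : ∀ t ∈ n.primeFactors.powerset, ∀ p ∈ t, p.Prime := fun t ht p hp ↦
    Nat.prime_of_mem_primeFactors (mem_powerset.mp ht hp)
  have hfac : ∀ t ∈ n.primeFactors.powerset, (∏ p ∈ t, p).primeFactors = t := fun t ht ↦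
    Nat.primeFactors_prod (hprime t ht)
  calc (m + 1) ^ n.primeFactors.card
      = ∑ t ∈ n.primeFactors.powerset, m ^ t.card := by
        rw [← sum_pow_mul_eq_add_pow]; simp
    _ = ∑ t ∈ n.primeFactors.powerset, m ^ (∏ p ∈ t, p).primeFactors.card :=
        sum_congr rfl fun t ht ↦ by rw [hfac t ht]
    _ = ∑ d ∈ n.primeFactors.powerset.image (fun t ↦ ∏ p ∈ t, p), m ^ d.primeFactors.card := by
        rw [sum_image]
        intro t ht t' ht' h
        rw [← hfac t ht, ← hfac t' ht']
        exact congrArg Nat.primeFactors h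
    _ ≤ _ := by
        refine sum_le_sum_of_subset (image_subset_iff.mpr fun t ht ↦ Nat.mem_divisors.mpr ⟨?_, hn⟩)
        exact (prod_dvd_prod_of_subset _ _ _ (mem_powerset.mp ht)).trans (Nat.prod_primeFactors_dvd n)

open Finset ArithmeticFunction in
theorem sum_pow_card_primeFactors_le (m N : ℕ) :
    ∑ n ∈ Ioc 0 N, ((m : ℝ) + 1) ^ n.primeFactors.card ≤ N * (1 + Real.log N) ^ m := by
  induction m generalizing N with
  | zero => simp
  | succ m ih =>
    let f : ArithmeticFunction ℕ :=
      ⟨fun n ↦ if n = 0 then 0 else (m + 1) ^ n.primeFactors.card, by simp⟩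
    have hf : ∀ n ≠ 0, f n = (m + 1) ^ n.primeFactors.card := fun n hn ↦ if_neg hn
    have hnat : ∑ n ∈ Ioc 0 N, (m + 1 + 1) ^ n.primeFactors.card ≤
        ∑ e ∈ Ioc 0 N, ∑ n ∈ Ioc 0 (N / e), (m + 1) ^ n.primeFactors.card := by
      calc _ ≤ ∑ n ∈ Ioc 0 N, (((zeta : ArithmeticFunction ℕ) * f) n) := by
            refine sum_le_sum fun n hn ↦ ?_
            have hn0 : n ≠ 0 := by simp at hn; lia
            refine (succ_pow_card_primeFactors_le_sum_divisors (m + 1) n hn0).trans_eq ?_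
            rw [zeta_mul_apply]
            exact sum_congr rfl fun d hd ↦ (hf d (Nat.pos_of_mem_divisors hd).ne').symm
        _ = _ := by
            rw [sum_Ioc_mul_eq_sum_sum]
            refine sum_congr rfl fun e he ↦ ?_
            rw [zeta_apply_ne (by simp at he; lia), one_mul]
            exact sum_congr rfl fun n hn ↦ hf n (by simp at hn; lia)
    have hreal : ∑ n ∈ Ioc 0 N, (((m + 1 : ℕ) : ℝ) + 1) ^ n.primeFactors.card ≤
        ∑ e ∈ Ioc 0 N, ∑ n ∈ Ioc 0 (N / e), ((m : ℝ) + 1) ^ n.primeFactors.card := by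
      exact_mod_cast hnat
    rcases Nat.eq_zero_or_pos N with rfl | hN
    · simp
    have hlogN : 0 ≤ Real.log N := Real.log_natCast_nonneg N
    calc _ ≤ _ := hreal
      _ ≤ ∑ e ∈ Ioc 0 N, (N : ℝ) * (1 + Real.log N) ^ m * (e : ℝ)⁻¹ := by
          refine sum_le_sum fun e he ↦ (ih (N / e)).trans ?_
          have he0 : 0 < e := (mem_Ioc.mp he).1
          have hpos : 0 < N / e := Nat.div_pos (mem_Ioc.mp he).2 he0
          have hl0 : 0 ≤ Real.log ((N / e : ℕ) : ℝ) := Real.log_natCast_nonneg _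
          have hl : Real.log ((N / e : ℕ) : ℝ) ≤ Real.log N :=
            Real.log_le_log (by exact_mod_cast hpos) (by exact_mod_cast Nat.div_le_self N e)
          rw [mul_right_comm, ← div_eq_mul_inv]
          gcongr
          exact Nat.cast_div_le
      _ = N * (1 + Real.log N) ^ m * (harmonic N : ℝ) := by
          rw [← mul_sum, harmonic_eq_sum_Icc]
          push_cast
          rfl
      _ ≤ N * (1 + Real.log N) ^ m * (1 + Real.log N) := by
          gcongr
          exact harmonic_le_one_add_log N
      _ = _ := by ring

open Finset in
theorem card_Ioc_filter_natCast_eq_le (a b : ℕ) {n : ℕ} (hn : 0 < n) (y : ZMod n) :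
    #{j ∈ Ioc a b | ((j : ℕ) : ZMod n) = y} ≤ (b - a) / n + 1 := by
  have : NeZero n := ⟨hn.ne'⟩
  have hfilter : {j ∈ Ioc a b | ((j : ℕ) : ZMod n) = y} = {j ∈ Ioc a b | j ≡ y.val [MOD n]} := by
    refine filter_congr fun j _ ↦ ?_
    rw [← ZMod.natCast_eq_natCast_iff, ZMod.natCast_zmod_val]
  rcases le_or_gt b a with hab | hab
  · simp [Ioc_eq_empty_of_le hab]
  rw [hfilter, ← Int.ofNat_le, Nat.Ioc_filter_modEq_card a b hn]
  refine max_le ?_ (by positivity)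
  have hn' : (0 : ℚ) < n := by exact_mod_cast hn
  have h1 := Int.floor_le (((b : ℚ) - y.val) / n)
  have h2 := Int.lt_floor_add_one (((a : ℚ) - y.val) / n)
  set d := ⌊((b : ℚ) - y.val) / n⌋ - ⌊((a : ℚ) - y.val) / n⌋ with hd
  have h3 : (d : ℚ) - 1 < ((b : ℚ) - a) / n := by
    have : ((b : ℚ) - a) / n = (b - y.val) / n - (a - y.val) / n := by ring
    rw [this, hd]
    push_cast
    linarith
  rw [lt_div_iff₀ hn'] at h3
  have h4 : (d - 1) * n < ((b - a : ℕ) : ℤ) := by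
    rw [Nat.cast_sub hab.le]
    exact_mod_cast h3
  push_cast
  have h5 : d - 1 ≤ ((b - a : ℕ) : ℤ) / n :=
    (Int.le_ediv_iff_mul_le (by exact_mod_cast hn)).mpr h4.le
  linarith

theorem ncard_pow_mul_eq_le {R : Type*} [CommRing R] [Finite R] (s : ℕ) (hs : s ≠ 0) (u c : R)
    (hc : IsUnit c) : {y : R | y ^ s * u = c}.ncard ≤ {x : Rˣ | x ^ s = 1}.ncard := by
  rcases Set.eq_empty_or_nonempty {y : R | y ^ s * u = c} with h | ⟨y₀, hy₀⟩
  · simp [h]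
  have hunit : ∀ y ∈ {y : R | y ^ s * u = c}, IsUnit y := fun y hy ↦
    (isUnit_pow_iff hs).mp (isUnit_of_mul_isUnit_left (y := u) (by
      rw [show y ^ s * u = c from hy]; exact hc))
  have hu : IsUnit u := isUnit_of_mul_isUnit_right (x := y₀ ^ s) (by
    rw [show y₀ ^ s * u = c from hy₀]; exact hc)
  obtain ⟨z, rfl⟩ := hunit y₀ hy₀
  refine (Set.ncard_le_ncard (t := (fun x : Rˣ ↦ (z * x : R)) '' {x : Rˣ | x ^ s = 1}) ?_
    (Set.toFinite _)).trans (Set.ncard_image_le (Set.toFinite _))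
  intro y hy
  obtain ⟨w, rfl⟩ := hunit y hy
  refine ⟨z⁻¹ * w, ?_, by simp⟩
  have hpow : (w : R) ^ s = (z : R) ^ s :=
    hu.mul_right_cancel ((show (w : R) ^ s * u = c from hy).trans hy₀.symm)
  have hpow' : w ^ s = z ^ s := Units.ext (by simpa using hpow)
  simp [mul_pow, hpow']

open Finset in
theorem card_Ioc_filter_pow_mul_eq_le (a b u : ℕ) {k s : ℕ} (hk : 0 < k) (hs : 0 < s)
    (c : ZMod (k ^ s)) (hc : IsUnit c) :
    #{j ∈ Ioc a b | ((j : ℕ) : ZMod (k ^ s)) ^ s * u = c} ≤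
      ((b - a) / k ^ s + 1) * (2 * s ^ k.primeFactors.card) := by
  classical
  have hn : 0 < k ^ s := by positivity
  have : NeZero (k ^ s) := ⟨hn.ne'⟩
  refine (card_le_mul_card_image (f := fun j : ℕ ↦ (j : ZMod (k ^ s))) _
    ((b - a) / k ^ s + 1) fun y _ ↦ ?_).trans (Nat.mul_le_mul_left _ ?_)
  · exact (card_le_card (filter_subset_filter _ (filter_subset _ _))).trans
      (card_Ioc_filter_natCast_eq_le a b hn y)
  · calc _ ≤ {y : ZMod (k ^ s) | y ^ s * u = c}.ncard := by
          rw [← Set.ncard_coe_finset]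
          refine Set.ncard_le_ncard (fun y hy ↦ ?_) (Set.toFinite _)
          obtain ⟨j, hj, rfl⟩ := mem_image.mp (mem_coe.mp hy)
          exact (mem_filter.mp hj).2
      _ ≤ _ := ncard_pow_mul_eq_le s hs.ne' _ c hc
      _ ≤ _ := ZMod.ncard_units_pow_eq_one_le hn.ne' hs
      _ ≤ _ := by
          rw [Nat.primeFactors_pow _ hs.ne']
          exact Nat.mul_le_mul_right _ (Nat.gcd_le_left _ two_pos)

open Finset in
theorem sum_Ioc_floor_pow_card_primeFactors_le {s : ℕ} (hs : 2 ≤ s) {x K : ℝ} (hx : 2 ≤ x)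
    (hK : 1 ≤ K) (hKx : K ^ s ≤ x) :
    ∑ k ∈ Ioc ⌊K⌋₊ ⌊2 * K⌋₊, (s : ℝ) ^ k.primeFactors.card ≤
      2 * K * (4 * Real.log x) ^ (s - 1) := by
  obtain ⟨m, rfl⟩ : ∃ m, s = m + 1 := ⟨s - 1, by lia⟩
  have hN : (⌊2 * K⌋₊ : ℝ) ≤ 2 * K := Nat.floor_le (by positivity)
  have hN0 : 0 < ⌊2 * K⌋₊ := Nat.floor_pos.mpr (by linarith)
  have hlog2 : 0.69 < Real.log 2 := by linarith [Real.log_two_gt_d9]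
  have hlogx : Real.log 2 ≤ Real.log x := Real.log_le_log two_pos hx
  have hKx' : K ≤ x := (le_self_pow₀ hK (by lia)).trans hKx
  have hlogN : Real.log ⌊2 * K⌋₊ ≤ Real.log 2 + Real.log x := by
    rw [← Real.log_mul (by norm_num) (by linarith)]
    exact Real.log_le_log (by exact_mod_cast hN0) (by linarith)
  have hlogN0 : 0 ≤ Real.log ⌊2 * K⌋₊ := Real.log_natCast_nonneg _
  calc _ ≤ ∑ k ∈ Ioc 0 ⌊2 * K⌋₊, ((m : ℝ) + 1) ^ k.primeFactors.card := by
        push_cast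
        exact sum_le_sum_of_subset_of_nonneg (Ioc_subset_Ioc_left (Nat.zero_le _))
          fun _ _ _ ↦ by positivity
    _ ≤ _ := sum_pow_card_primeFactors_le m _
    _ ≤ _ := by
        rw [Nat.add_sub_cancel]
        gcongr
        linarith

open Finset in
theorem ncard_solutions_le_sum (s : ℕ) {η : ℤ} (hη : -1 ≤ η) {x J K : ℝ} (hx : 1 ≤ x)
    (hJ : 0 < J) :
    {p : ℕ × ℕ × ℕ × ℕ |
          0 < p.1 ∧ 0 < p.2.1 ∧ 0 < p.2.2.1 ∧ 0 < p.2.2.2 ∧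
          J < (p.1 : ℝ) ∧ (p.1 : ℝ) ≤ 2 * J ∧ K < (p.2.1 : ℝ) ∧ (p.2.1 : ℝ) ≤ 2 * K ∧
          (p.1 : ℤ) ^ s * (p.2.2.1 : ℤ) + η = (p.2.1 : ℤ) ^ s * (p.2.2.2 : ℤ) ∧
          (p.2.1 : ℝ) ^ s * (p.2.2.2 : ℝ) ≤ x}.ncard ≤
      ∑ k ∈ Ioc ⌊K⌋₊ ⌊2 * K⌋₊, ∑ u ∈ Ioc 0 ⌊2 * x / J ^ s⌋₊,
        #{j ∈ Ioc ⌊J⌋₊ ⌊2 * J⌋₊ | ((j : ℕ) : ZMod (k ^ s)) ^ s * (u : ℕ) = -η} := by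
  rw [← sum_product', ← card_sigma, ← Set.ncard_coe_finset]
  refine Set.ncard_le_ncard_of_injOn (fun p ↦ ⟨(p.2.1, p.2.2.1), p.1⟩) ?_ ?_ (Set.toFinite _)
  · rintro ⟨j, k, u, v⟩ ⟨-, hk, hu, -, hj1, hj2, hk1, hk2, heq, hv⟩
    have hK2 : 0 ≤ 2 * K := (Nat.cast_nonneg k).trans hk2
    have hu' : (u : ℝ) ≤ 2 * x / J ^ s := by
      rw [le_div_iff₀ (by positivity)]
      have hreal : (j : ℝ) ^ s * u + η = (k : ℝ) ^ s * v := by exact_mod_cast heq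
      have hη' : (-1 : ℝ) ≤ η := by exact_mod_cast hη
      calc (u : ℝ) * J ^ s ≤ u * (j : ℝ) ^ s := by gcongr
        _ ≤ 2 * x := by linarith
    have hmod : ((j : ℕ) : ZMod (k ^ s)) ^ s * (u : ℕ) = -η := by
      have h := congrArg (Int.cast : ℤ → ZMod (k ^ s)) heq
      push_cast at h
      rw [← Nat.cast_pow k, ZMod.natCast_self, zero_mul] at h
      exact eq_neg_of_add_eq_zero_left h
    simp only [coe_sigma, Set.mem_sigma_iff, mem_coe, mem_product, mem_filter, mem_Ioc]
    exact ⟨⟨⟨(Nat.floor_lt (by linarith)).mpr hk1, Nat.le_floor hk2⟩, hu, Nat.le_floor hu'⟩,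
      ⟨(Nat.floor_lt hJ.le).mpr hj1, Nat.le_floor hj2⟩, hmod⟩
  · rintro ⟨j, k, u, v⟩ ⟨-, hk, -, -, -, -, -, -, heq, -⟩ ⟨j', k', u', v'⟩
      ⟨-, -, -, -, -, -, -, -, heq', -⟩ h
    simp only [Sigma.mk.injEq, Prod.mk.injEq, heq_eq_eq] at h
    obtain ⟨⟨rfl, rfl⟩, rfl⟩ := h
    have hk0 : (k : ℤ) ^ s ≠ 0 := by positivity
    have hvv : (v : ℤ) = v' := mul_left_cancel₀ hk0 (heq.symm.trans heq')
    simpa using hvv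

open Finset in
theorem sum_card_Ioc_filter_pow_mul_eq_le {s : ℕ} (hs : 2 ≤ s) {η : ℤ} (hη : η = 1 ∨ η = -1)
    {x J K : ℝ} (hx : 2 ≤ x) (hJ : 1 ≤ J) (hK : 1 ≤ K) (hKx : K ^ s ≤ x) :
    ∑ k ∈ Ioc ⌊K⌋₊ ⌊2 * K⌋₊, ∑ u ∈ Ioc 0 ⌊2 * x / J ^ s⌋₊,
        (#{j ∈ Ioc ⌊J⌋₊ ⌊2 * J⌋₊ | ((j : ℕ) : ZMod (k ^ s)) ^ s * (u : ℕ) = -η} : ℝ) ≤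
      16 * 4 ^ (s - 1) * x * ((J ^ s)⁻¹ * K + J * K / (J * K) ^ s) * Real.log x ^ (s - 1) := by
  have hJ0 : 0 < J := by linarith
  have hK0 : 0 < K := by linarith
  have hx0 : 0 < x := by linarith
  have hlog : 0 ≤ Real.log x := Real.log_nonneg (by linarith)
  have hcard : ∀ k ∈ Ioc ⌊K⌋₊ ⌊2 * K⌋₊, ∀ u ∈ Ioc 0 ⌊2 * x / J ^ s⌋₊,
      (#{j ∈ Ioc ⌊J⌋₊ ⌊2 * J⌋₊ | ((j : ℕ) : ZMod (k ^ s)) ^ s * (u : ℕ) = -η} : ℝ) ≤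
        (2 * J / K ^ s + 1) * (2 * (s : ℝ) ^ k.primeFactors.card) := by
    intro k hk u _
    have hkK : K < k := (Nat.floor_lt hK0.le).mp (mem_Ioc.mp hk).1
    have hk0 : 0 < k := by exact_mod_cast hK0.trans hkK
    have hunit : IsUnit (-η : ZMod (k ^ s)) := by rcases hη with rfl | rfl <;> simp
    have h := card_Ioc_filter_pow_mul_eq_le ⌊J⌋₊ ⌊2 * J⌋₊ u hk0 (by lia : 0 < s) _ hunit
    refine (Nat.cast_le (α := ℝ).mpr h).trans ?_
    push_cast
    gcongr
    calc (((⌊2 * J⌋₊ - ⌊J⌋₊) / k ^ s : ℕ) : ℝ) ≤ ((⌊2 * J⌋₊ - ⌊J⌋₊ : ℕ) : ℝ) / (k ^ s : ℕ) :=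
          Nat.cast_div_le
      _ ≤ (⌊2 * J⌋₊ : ℝ) / (k : ℝ) ^ s := by
          push_cast
          gcongr
          exact Nat.sub_le _ _
      _ ≤ 2 * J / K ^ s := by
          gcongr
          exact Nat.floor_le (by positivity)
  calc _ ≤ ∑ k ∈ Ioc ⌊K⌋₊ ⌊2 * K⌋₊, ∑ u ∈ Ioc 0 ⌊2 * x / J ^ s⌋₊,
        (2 * J / K ^ s + 1) * (2 * (s : ℝ) ^ k.primeFactors.card) :=
        sum_le_sum fun k hk ↦ sum_le_sum fun u hu ↦ hcard k hk u hu
    _ = ⌊2 * x / J ^ s⌋₊ * (2 * J / K ^ s + 1) * 2 *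
        ∑ k ∈ Ioc ⌊K⌋₊ ⌊2 * K⌋₊, (s : ℝ) ^ k.primeFactors.card := by
        rw [mul_sum]
        refine sum_congr rfl fun k _ ↦ ?_
        rw [sum_const, Nat.card_Ioc, nsmul_eq_mul, Nat.sub_zero]
        ring
    _ ≤ (2 * x / J ^ s) * (2 * J / K ^ s + 1) * 2 * (2 * K * (4 * Real.log x) ^ (s - 1)) := by
        gcongr
        · exact Nat.floor_le (by positivity)
        · exact sum_Ioc_floor_pow_card_primeFactors_le hs hx hK hKx
    _ = 8 * 4 ^ (s - 1) * x * ((J ^ s)⁻¹ * K + 2 * (J * K / (J * K) ^ s)) *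
        Real.log x ^ (s - 1) := by
        rw [mul_pow, mul_pow]
        field_simp
        ring
    _ ≤ 8 * 4 ^ (s - 1) * x * (2 * ((J ^ s)⁻¹ * K + J * K / (J * K) ^ s)) *
        Real.log x ^ (s - 1) := by
        gcongr
        have : 0 ≤ (J ^ s)⁻¹ * K := by positivity
        linarith
    _ = _ := by ring

theorem stmt_5 (s : ℕ) (hs : 2 ≤ s) (η : ℤ) (hη : η = 1 ∨ η = -1) :
    ∃ C : ℝ, 0 < C ∧ ∀ x : ℝ, 2 ≤ x → ∀ J K : ℝ, 1 ≤ J → 1 ≤ K →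
      (({(j, k, u, v) : ℕ × ℕ × ℕ × ℕ |
          0 < j ∧ 0 < k ∧ 0 < u ∧ 0 < v ∧
          J < (j : ℝ) ∧ (j : ℝ) ≤ 2 * J ∧ K < (k : ℝ) ∧ (k : ℝ) ≤ 2 * K ∧
          (j : ℤ) ^ s * (u : ℤ) + η = (k : ℤ) ^ s * (v : ℤ) ∧
          (k : ℝ) ^ s * (v : ℝ) ≤ x}.ncard : ℝ)) ≤
        C * x * (J ^ (-(s : ℝ)) * K + (J * K) ^ (1 - (s : ℝ))) *
          Real.log x ^ (s - 1) := by
  refine ⟨16 * 4 ^ (s - 1), by positivity, fun x hx J K hJ hK ↦ ?_⟩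
  have hJ0 : 0 < J := by linarith
  have hK0 : 0 < K := by linarith
  have hx0 : 0 < x := by linarith
  have hlog : 0 ≤ Real.log x := Real.log_nonneg (by linarith)
  have hrpow : (J * K) ^ (1 - (s : ℝ)) = J * K / (J * K) ^ s := by
    rw [Real.rpow_sub (by positivity), Real.rpow_one, Real.rpow_natCast]
  rw [hrpow, Real.rpow_neg hJ0.le, Real.rpow_natCast]
  by_cases hKx : K ^ s ≤ x
  swap
  · refine le_of_eq_of_le ?_ (by positivity :
      0 ≤ 16 * 4 ^ (s - 1) * x * ((J ^ s)⁻¹ * K + J * K / (J * K) ^ s) * Real.log x ^ (s - 1))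
    rw [Nat.cast_eq_zero]
    convert Set.ncard_empty (ℕ × ℕ × ℕ × ℕ)
    refine Set.eq_empty_of_forall_notMem ?_
    rintro ⟨j, k, u, v⟩ ⟨-, -, -, hv, -, -, hk, -, -, hle⟩
    refine hKx (le_trans ?_ hle)
    have hv1 : (1 : ℝ) ≤ v := by exact_mod_cast hv
    calc K ^ s ≤ (k : ℝ) ^ s := by gcongr
      _ ≤ (k : ℝ) ^ s * v := le_mul_of_one_le_right (by positivity) hv1
  have hcount := ncard_solutions_le_sum s (K := K) (by lia : -1 ≤ η) (by linarith : 1 ≤ x) hJ0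
  refine (Nat.cast_le (α := ℝ).mpr hcount).trans ?_
  push_cast
  exact sum_card_Ioc_filter_pow_mul_eq_le hs hη hx hJ hK hKx
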